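/- (Corollary 1.) For θ ∈ ℝⁿ and A_j = A_i ∪ {j}, the combined primal–dual feasibility conditions G z_{A_j}(θ) ≤ b + Sθ and λ_{A_j}(θ) ≥ 0 hold if and only if: (i) for every row index k ∉ A_j: G_k (z_{A_i}(θ)) + (G f_j)_k (c_j + v_jᵀθ) ≤ b_k + S_k θ, and (ii) for every index k ∈ A_j: λ̃_{A_i}(θ)_k − (d̃_j)_k (c_j + v_jᵀθ) ≥ 0. In particular, the rows of G z_{A_j}(θ) ≤ b + Sθ indexed by A_j hold automatically with equality. -/

import Mathlib

open Matrix

noncomputable section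
namespace MpQP

/-- Submatrix of the rows of `G` indexed by the finite index set `A`. -/
def subRows {nc p : ℕ} (G : Matrix (Fin nc) (Fin p) ℝ) (A : Finset (Fin nc)) :
    Matrix A (Fin p) ℝ := Matrix.of fun i k => G i.val k

/-- Subvector of `b` indexed by `A`. -/
def subVec {nc : ℕ} (b : Fin nc → ℝ) (A : Finset (Fin nc)) : A → ℝ := fun i => b i.val

/-- `G_A` has full row rank, i.e. the rows of `G` indexed by `A` are linearly independent. -/
def FullRowRank {nc m : ℕ} (G : Matrix (Fin nc) (Fin m) ℝ) (A : Finset (Fin nc)) : Prop :=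
  LinearIndependent ℝ (fun i : A => G i.val)

/-- The parametric dual solution `λ_A(θ) = −(G_A H⁻¹ G_Aᵀ)⁻¹ (b_A + S_A θ)`. -/
def lamOf {m n nc : ℕ} (H : Matrix (Fin m) (Fin m) ℝ) (G : Matrix (Fin nc) (Fin m) ℝ)
    (b : Fin nc → ℝ) (S : Matrix (Fin nc) (Fin n) ℝ) (A : Finset (Fin nc))
    (θ : Fin n → ℝ) : A → ℝ :=
  -((subRows G A * H⁻¹ * (subRows G A)ᵀ)⁻¹.mulVec
      (fun i => b i.val + S.mulVec θ i.val))

/-- The parametric primal solution `z_A(θ) = −H⁻¹ G_Aᵀ λ_A(θ)`. -/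
def zOf {m n nc : ℕ} (H : Matrix (Fin m) (Fin m) ℝ) (G : Matrix (Fin nc) (Fin m) ℝ)
    (b : Fin nc → ℝ) (S : Matrix (Fin nc) (Fin n) ℝ) (A : Finset (Fin nc))
    (θ : Fin n → ℝ) : Fin m → ℝ :=
  -((H⁻¹ * (subRows G A)ᵀ).mulVec (lamOf H G b S A θ))

/-- `λ̃_A(θ) ∈ ℝ^{n_c}`: the dual solution extended by zeros outside `A`. -/
def lamExt {m n nc : ℕ} (H : Matrix (Fin m) (Fin m) ℝ) (G : Matrix (Fin nc) (Fin m) ℝ)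
    (b : Fin nc → ℝ) (S : Matrix (Fin nc) (Fin n) ℝ) (A : Finset (Fin nc))
    (θ : Fin n → ℝ) : Fin nc → ℝ :=
  fun k => if h : k ∈ A then lamOf H G b S A θ ⟨k, h⟩ else 0

/-- `W = G_A H⁻¹ G_Aᵀ`. -/
def Wmat {m nc : ℕ} (H : Matrix (Fin m) (Fin m) ℝ) (G : Matrix (Fin nc) (Fin m) ℝ)
    (A : Finset (Fin nc)) : Matrix A A ℝ :=
  subRows G A * H⁻¹ * (subRows G A)ᵀ

/-- `w = G_A H⁻¹ G_jᵀ`. -/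
def wvec {m nc : ℕ} (H : Matrix (Fin m) (Fin m) ℝ) (G : Matrix (Fin nc) (Fin m) ℝ)
    (A : Finset (Fin nc)) (j : Fin nc) : A → ℝ :=
  (subRows G A * H⁻¹).mulVec (G j)

/-- `w₀ = G_j H⁻¹ G_jᵀ`. -/
def w0 {m nc : ℕ} (H : Matrix (Fin m) (Fin m) ℝ) (G : Matrix (Fin nc) (Fin m) ℝ)
    (j : Fin nc) : ℝ :=
  G j ⬝ᵥ H⁻¹.mulVec (G j)

/-- The Schur complement `C = w₀ − wᵀ W⁻¹ w`. -/
def Cval {m nc : ℕ} (H : Matrix (Fin m) (Fin m) ℝ) (G : Matrix (Fin nc) (Fin m) ℝ)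
    (A : Finset (Fin nc)) (j : Fin nc) : ℝ :=
  w0 H G j - wvec H G A j ⬝ᵥ (Wmat H G A)⁻¹.mulVec (wvec H G A j)

/-- `c_j = C⁻¹ (wᵀ W⁻¹ b_A − b_j)`. -/
def cVal {m nc : ℕ} (H : Matrix (Fin m) (Fin m) ℝ) (G : Matrix (Fin nc) (Fin m) ℝ)
    (b : Fin nc → ℝ) (A : Finset (Fin nc)) (j : Fin nc) : ℝ :=
  (Cval H G A j)⁻¹ * (wvec H G A j ⬝ᵥ (Wmat H G A)⁻¹.mulVec (subVec b A) - b j)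

/-- `v_j = C⁻¹ (S_Aᵀ W⁻¹ w − S_jᵀ)`. -/
def vVec {m n nc : ℕ} (H : Matrix (Fin m) (Fin m) ℝ) (G : Matrix (Fin nc) (Fin m) ℝ)
    (S : Matrix (Fin nc) (Fin n) ℝ) (A : Finset (Fin nc)) (j : Fin nc) : Fin n → ℝ :=
  (Cval H G A j)⁻¹ •
    ((subRows S A)ᵀ.mulVec ((Wmat H G A)⁻¹.mulVec (wvec H G A j)) - S j)

/-- `d̃_j ∈ ℝ^{n_c}`: equal to `W⁻¹ w` on `A`, to `−1` at index `j`, and `0` elsewhere. -/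
def dExt {m nc : ℕ} (H : Matrix (Fin m) (Fin m) ℝ) (G : Matrix (Fin nc) (Fin m) ℝ)
    (A : Finset (Fin nc)) (j : Fin nc) : Fin nc → ℝ :=
  fun k =>
    if h : k ∈ A then (Wmat H G A)⁻¹.mulVec (wvec H G A j) ⟨k, h⟩
    else if k = j then -1 else 0

/-- `f_j = H⁻¹ G_{A ∪ {j}}ᵀ (d̃_j restricted to A ∪ {j})`. -/
def fVec {m nc : ℕ} (H : Matrix (Fin m) (Fin m) ℝ) (G : Matrix (Fin nc) (Fin m) ℝ)
    (A : Finset (Fin nc)) (j : Fin nc) : Fin m → ℝ :=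
  (H⁻¹ * (subRows G (insert j A))ᵀ).mulVec (fun i => dExt H G A j i.val)


/-- Extension by zeros of a vector indexed by `A`. -/
def extendZero {nc : ℕ} (A : Finset (Fin nc)) (u : A → ℝ) : Fin nc → ℝ :=
  fun k => if h : k ∈ A then u ⟨k, h⟩ else 0

lemma extendZero_of_notMem {nc : ℕ} {A : Finset (Fin nc)} (u : A → ℝ) {k : Fin nc}
    (hk : k ∉ A) : extendZero A u k = 0 := dif_neg hk

@[simp]
lemma extendZero_coe {nc : ℕ} {A : Finset (Fin nc)} (u : A → ℝ) (i : A) :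
    extendZero A u i = u i := by
  simp [extendZero]

lemma subRows_transpose_mulVec {nc p : ℕ} (G : Matrix (Fin nc) (Fin p) ℝ)
    {A : Finset (Fin nc)} {x : Fin nc → ℝ} (hx : ∀ k ∉ A, x k = 0) :
    (subRows G A)ᵀ *ᵥ (fun i : A => x i) = Gᵀ *ᵥ x := by
  ext l
  simp only [mulVec, dotProduct, transpose_apply, subRows, of_apply]
  rw [Finset.sum_coe_sort A (fun k => G k l * x k)]
  exact Finset.sum_subset (Finset.subset_univ A) fun k _ hk => by simp [hx k hk]

lemma subRows_transpose_mulVec_eq_extendZero {nc p : ℕ} (G : Matrix (Fin nc) (Fin p) ℝ)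
    {A : Finset (Fin nc)} (u : A → ℝ) :
    (subRows G A)ᵀ *ᵥ u = Gᵀ *ᵥ extendZero A u := by
  rw [← subRows_transpose_mulVec G (A := A) fun k hk => extendZero_of_notMem u hk]
  simp

lemma Wmat_mulVec_apply {m nc : ℕ} (H : Matrix (Fin m) (Fin m) ℝ)
    (G : Matrix (Fin nc) (Fin m) ℝ) {A : Finset (Fin nc)} {x : Fin nc → ℝ}
    (hx : ∀ k ∉ A, x k = 0) (i : A) :
    (Wmat H G A *ᵥ fun i : A => x i) i = ((G * H⁻¹ * Gᵀ) *ᵥ x) i := by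
  rw [Wmat, ← mulVec_mulVec, ← mulVec_mulVec, subRows_transpose_mulVec G hx,
    ← mulVec_mulVec, ← mulVec_mulVec]
  rfl

lemma posDef_Wmat {m nc : ℕ} {H : Matrix (Fin m) (Fin m) ℝ} (hH : H.PosDef)
    {G : Matrix (Fin nc) (Fin m) ℝ} {A : Finset (Fin nc)} (hA : FullRowRank G A) :
    (Wmat H G A).PosDef := by
  have h := hH.inv.mul_mul_conjTranspose_same (B := subRows G A)
    (vecMul_injective_iff.mpr hA)
  rwa [conjTranspose_eq_transpose_of_trivial] at h

lemma Wmat_mulVec_inv_mulVec {m nc : ℕ} {H : Matrix (Fin m) (Fin m) ℝ} (hH : H.PosDef)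
    {G : Matrix (Fin nc) (Fin m) ℝ} {A : Finset (Fin nc)} (hA : FullRowRank G A)
    (u : A → ℝ) : Wmat H G A *ᵥ ((Wmat H G A)⁻¹ *ᵥ u) = u := by
  rw [mulVec_mulVec, mul_nonsing_inv _ ((isUnit_iff_isUnit_det _).mp (posDef_Wmat hH hA).isUnit),
    one_mulVec]

lemma gram_mulVec_extendZero_inv {m nc : ℕ} {H : Matrix (Fin m) (Fin m) ℝ} (hH : H.PosDef)
    {G : Matrix (Fin nc) (Fin m) ℝ} {A : Finset (Fin nc)} (hA : FullRowRank G A)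
    (u : A → ℝ) (i : A) :
    ((G * H⁻¹ * Gᵀ) *ᵥ extendZero A ((Wmat H G A)⁻¹ *ᵥ u)) i = u i := by
  rw [← Wmat_mulVec_apply H G fun k hk => extendZero_of_notMem _ hk]
  simp only [extendZero_coe]
  rw [Wmat_mulVec_inv_mulVec hH hA]

lemma eq_of_gram_mulVec_eq {m nc : ℕ} {H : Matrix (Fin m) (Fin m) ℝ} (hH : H.PosDef)
    {G : Matrix (Fin nc) (Fin m) ℝ} {A : Finset (Fin nc)} (hA : FullRowRank G A)
    {x y : Fin nc → ℝ} (hx : ∀ k ∉ A, x k = 0) (hy : ∀ k ∉ A, y k = 0)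
    (h : ∀ k ∈ A, ((G * H⁻¹ * Gᵀ) *ᵥ x) k = ((G * H⁻¹ * Gᵀ) *ᵥ y) k) : x = y := by
  have hinj := mulVec_injective_iff_isUnit.mpr (posDef_Wmat hH hA).isUnit
  have hxy : (fun i : A => x i) = fun i : A => y i := hinj <| funext fun i => by
    rw [Wmat_mulVec_apply H G hx, Wmat_mulVec_apply H G hy, h i i.2]
  ext k
  by_cases hk : k ∈ A
  · exact congrFun hxy ⟨k, hk⟩
  · rw [hx k hk, hy k hk]

lemma gram_mulVec_lamExt {m n nc : ℕ} {H : Matrix (Fin m) (Fin m) ℝ} (hH : H.PosDef)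
    {G : Matrix (Fin nc) (Fin m) ℝ} (b : Fin nc → ℝ) (S : Matrix (Fin nc) (Fin n) ℝ)
    {A : Finset (Fin nc)} (hA : FullRowRank G A) (θ : Fin n → ℝ) {k : Fin nc} (hk : k ∈ A) :
    ((G * H⁻¹ * Gᵀ) *ᵥ lamExt H G b S A θ) k = -(b k + (S *ᵥ θ) k) := by
  have h := gram_mulVec_extendZero_inv hH hA (-fun i : A => b i + (S *ᵥ θ) i) ⟨k, hk⟩
  rwa [mulVec_neg] at h

lemma zOf_eq {m n nc : ℕ} (H : Matrix (Fin m) (Fin m) ℝ) (G : Matrix (Fin nc) (Fin m) ℝ)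
    (b : Fin nc → ℝ) (S : Matrix (Fin nc) (Fin n) ℝ) (A : Finset (Fin nc)) (θ : Fin n → ℝ) :
    zOf H G b S A θ = -((H⁻¹ * Gᵀ) *ᵥ lamExt H G b S A θ) := by
  rw [zOf, ← mulVec_mulVec, subRows_transpose_mulVec_eq_extendZero, mulVec_mulVec]
  rfl

lemma mulVec_zOf {m n nc : ℕ} (H : Matrix (Fin m) (Fin m) ℝ) (G : Matrix (Fin nc) (Fin m) ℝ)
    (b : Fin nc → ℝ) (S : Matrix (Fin nc) (Fin n) ℝ) (A : Finset (Fin nc)) (θ : Fin n → ℝ) :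
    G *ᵥ zOf H G b S A θ = -((G * H⁻¹ * Gᵀ) *ᵥ lamExt H G b S A θ) := by
  rw [zOf_eq, mulVec_neg, mulVec_mulVec, Matrix.mul_assoc]

lemma dExt_of_notMem {m nc : ℕ} (H : Matrix (Fin m) (Fin m) ℝ)
    (G : Matrix (Fin nc) (Fin m) ℝ) {A : Finset (Fin nc)} {j k : Fin nc}
    (hk : k ∉ insert j A) : dExt H G A j k = 0 := by
  rw [Finset.mem_insert, not_or] at hk
  simp [dExt, hk.1, hk.2]

lemma dExt_eq {m nc : ℕ} (H : Matrix (Fin m) (Fin m) ℝ) (G : Matrix (Fin nc) (Fin m) ℝ)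
    {A : Finset (Fin nc)} {j : Fin nc} (hj : j ∉ A) :
    dExt H G A j = extendZero A ((Wmat H G A)⁻¹ *ᵥ wvec H G A j) - Pi.single j 1 := by
  ext k
  by_cases hk : k ∈ A
  · have hkj : k ≠ j := fun h => hj (h ▸ hk)
    simp [dExt, extendZero, hk, hkj]
  · by_cases hkj : k = j <;> simp [dExt, extendZero, hk, hkj, hj]

lemma mulVec_fVec {m nc : ℕ} (H : Matrix (Fin m) (Fin m) ℝ) (G : Matrix (Fin nc) (Fin m) ℝ)
    (A : Finset (Fin nc)) (j : Fin nc) :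
    G *ᵥ fVec H G A j = (G * H⁻¹ * Gᵀ) *ᵥ dExt H G A j := by
  rw [fVec, ← mulVec_mulVec, subRows_transpose_mulVec G fun k hk => dExt_of_notMem H G hk,
    mulVec_mulVec, mulVec_mulVec, Matrix.mul_assoc]

lemma gram_mulVec_single {m nc : ℕ} (H : Matrix (Fin m) (Fin m) ℝ)
    (G : Matrix (Fin nc) (Fin m) ℝ) (j : Fin nc) :
    (G * H⁻¹ * Gᵀ) *ᵥ Pi.single j 1 = G *ᵥ (H⁻¹ *ᵥ G j) := by
  have h : Gᵀ *ᵥ Pi.single j 1 = G j := by simp [Matrix.col]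
  rw [← mulVec_mulVec, h, mulVec_mulVec]

lemma gram_mulVec_extendZero_apply {m nc : ℕ} {H : Matrix (Fin m) (Fin m) ℝ} (hH : H.PosDef)
    (G : Matrix (Fin nc) (Fin m) ℝ) {A : Finset (Fin nc)} (u : A → ℝ) (j : Fin nc) :
    ((G * H⁻¹ * Gᵀ) *ᵥ extendZero A u) j = wvec H G A j ⬝ᵥ u := by
  have hsymm : H⁻¹ᵀ = H⁻¹ := by
    simpa only [conjTranspose_eq_transpose_of_trivial] using hH.inv.isHermitian.eq
  rw [← mulVec_mulVec, ← subRows_transpose_mulVec_eq_extendZero, ← mulVec_mulVec]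
  change G j ⬝ᵥ (H⁻¹ *ᵥ ((subRows G A)ᵀ *ᵥ u)) = _
  rw [wvec, dotProduct_mulVec, dotProduct_mulVec, vecMul_transpose, ← mulVec_mulVec,
    ← mulVec_transpose, hsymm]

lemma gram_mulVec_dExt_of_mem {m nc : ℕ} {H : Matrix (Fin m) (Fin m) ℝ} (hH : H.PosDef)
    {G : Matrix (Fin nc) (Fin m) ℝ} {A : Finset (Fin nc)} (hA : FullRowRank G A)
    {j : Fin nc} (hj : j ∉ A) {k : Fin nc} (hk : k ∈ A) :
    ((G * H⁻¹ * Gᵀ) *ᵥ dExt H G A j) k = 0 := by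
  rw [dExt_eq H G hj, mulVec_sub, Pi.sub_apply,
    gram_mulVec_extendZero_inv hH hA _ ⟨k, hk⟩, gram_mulVec_single, wvec, ← mulVec_mulVec]
  exact sub_self _

lemma gram_mulVec_dExt_self {m nc : ℕ} {H : Matrix (Fin m) (Fin m) ℝ} (hH : H.PosDef)
    (G : Matrix (Fin nc) (Fin m) ℝ) {A : Finset (Fin nc)} {j : Fin nc} (hj : j ∉ A) :
    ((G * H⁻¹ * Gᵀ) *ᵥ dExt H G A j) j = -Cval H G A j := by
  rw [dExt_eq H G hj, mulVec_sub, Pi.sub_apply, gram_mulVec_extendZero_apply hH,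
    gram_mulVec_single, Cval, neg_sub]
  rfl

lemma Cval_ne_zero {m nc : ℕ} {H : Matrix (Fin m) (Fin m) ℝ} (hH : H.PosDef)
    {G : Matrix (Fin nc) (Fin m) ℝ} {A : Finset (Fin nc)} (hA : FullRowRank G A)
    {j : Fin nc} (hj : j ∉ A) (hAj : FullRowRank G (insert j A)) : Cval H G A j ≠ 0 := by
  intro hC
  have hd : dExt H G A j = 0 :=
    eq_of_gram_mulVec_eq hH hAj (fun k hk => dExt_of_notMem H G hk) (fun _ _ => rfl)
      fun k hk => by
        rw [mulVec_zero, Pi.zero_apply]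
        rcases Finset.mem_insert.mp hk with rfl | hk
        · rw [gram_mulVec_dExt_self hH G hj, hC, neg_zero]
        · exact gram_mulVec_dExt_of_mem hH hA hj hk
  simpa [dExt, hj] using congrFun hd j

lemma Cval_mul_step {m n nc : ℕ} {H : Matrix (Fin m) (Fin m) ℝ}
    {G : Matrix (Fin nc) (Fin m) ℝ} (b : Fin nc → ℝ) (S : Matrix (Fin nc) (Fin n) ℝ)
    {A : Finset (Fin nc)} {j : Fin nc} (hC : Cval H G A j ≠ 0) (hW : (Wmat H G A)ᵀ = Wmat H G A)
    (θ : Fin n → ℝ) :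
    Cval H G A j * (cVal H G b A j + vVec H G S A j ⬝ᵥ θ) =
      -(wvec H G A j ⬝ᵥ lamOf H G b S A θ) - (b j + (S *ᵥ θ) j) := by
  have hr : (fun i : A => b i + (S *ᵥ θ) i) = subVec b A + subRows S A *ᵥ θ := rfl
  have hS : ((subRows S A)ᵀ *ᵥ ((Wmat H G A)⁻¹ *ᵥ wvec H G A j)) ⬝ᵥ θ =
      wvec H G A j ⬝ᵥ ((Wmat H G A)⁻¹ *ᵥ (subRows S A *ᵥ θ)) := by
    rw [mulVec_transpose, ← dotProduct_mulVec, dotProduct_mulVec (wvec H G A j),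
      ← mulVec_transpose, transpose_nonsing_inv, hW]
  have hj : (S *ᵥ θ) j = S j ⬝ᵥ θ := rfl
  rw [cVal, vVec, smul_dotProduct, smul_eq_mul, ← mul_add, mul_inv_cancel_left₀ hC,
    sub_dotProduct, hS, lamOf, hr, ← Wmat, mulVec_add, dotProduct_neg, dotProduct_add, hj]
  ring

/-- Adding the constraint `j` to the active set moves the extended dual solution along `d̃_j`. -/
lemma lamExt_insert {m n nc : ℕ} {H : Matrix (Fin m) (Fin m) ℝ} (hH : H.PosDef)
    {G : Matrix (Fin nc) (Fin m) ℝ} (b : Fin nc → ℝ) (S : Matrix (Fin nc) (Fin n) ℝ)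
    {A : Finset (Fin nc)} {j : Fin nc} (hj : j ∉ A) (hA : FullRowRank G A)
    (hAj : FullRowRank G (insert j A)) (θ : Fin n → ℝ) :
    lamExt H G b S (insert j A) θ = lamExt H G b S A θ -
      (cVal H G b A j + vVec H G S A j ⬝ᵥ θ) • dExt H G A j := by
  have hW : (Wmat H G A)ᵀ = Wmat H G A := by
    simpa only [conjTranspose_eq_transpose_of_trivial] using (posDef_Wmat hH hA).isHermitian.eq
  refine eq_of_gram_mulVec_eq hH hAj (fun k hk => dif_neg hk) (fun k hk => ?_) fun k hk => ?_
  · have hkA : k ∉ A := fun h => hk (Finset.mem_insert_of_mem h)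
    simp [dExt_of_notMem H G hk, lamExt, hkA]
  · rw [gram_mulVec_lamExt hH b S hAj θ hk, mulVec_sub, mulVec_smul, Pi.sub_apply,
      Pi.smul_apply, smul_eq_mul]
    rcases Finset.mem_insert.mp hk with rfl | hkA
    · have hstep := Cval_mul_step b S (Cval_ne_zero hH hA hj hAj) hW θ
      have hlam : ((G * H⁻¹ * Gᵀ) *ᵥ lamExt H G b S A θ) k =
          wvec H G A k ⬝ᵥ lamOf H G b S A θ := gram_mulVec_extendZero_apply hH G _ k
      rw [gram_mulVec_dExt_self hH G hj, hlam]
      linarith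
    · rw [gram_mulVec_dExt_of_mem hH hA hj hkA, gram_mulVec_lamExt hH b S hA θ hkA]
      ring

/-- Corollary 1: for `A_j = A_i ∪ {j}`, the combined primal–dual feasibility
`G z_{A_j}(θ) ≤ b + Sθ ∧ λ_{A_j}(θ) ≥ 0` holds iff (i) for every `k ∉ A_j`
`G_k z_{A_i}(θ) + (G f_j)_k (c_j + v_jᵀθ) ≤ b_k + S_k θ`, and (ii) for every
`k ∈ A_j` `λ̃_{A_i}(θ)_k − (d̃_j)_k (c_j + v_jᵀθ) ≥ 0`; moreover the rows of
`G z_{A_j}(θ) ≤ b + Sθ` indexed by `A_j` automatically hold with equality. -/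
theorem criticalRegion_add_constraint
    {m n nc : ℕ} (H : Matrix (Fin m) (Fin m) ℝ) (hH : H.PosDef)
    (G : Matrix (Fin nc) (Fin m) ℝ) (b : Fin nc → ℝ) (S : Matrix (Fin nc) (Fin n) ℝ)
    (Ai : Finset (Fin nc)) (j : Fin nc) (hj : j ∉ Ai)
    (hAi : FullRowRank G Ai) (hAj : FullRowRank G (insert j Ai)) (θ : Fin n → ℝ) :
    ((G.mulVec (zOf H G b S (insert j Ai) θ) ≤ b + S.mulVec θ ∧
        ∀ i : (insert j Ai : Finset (Fin nc)), 0 ≤ lamOf H G b S (insert j Ai) θ i) ↔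
      ((∀ k, k ∉ insert j Ai →
          G k ⬝ᵥ zOf H G b S Ai θ +
              G.mulVec (fVec H G Ai j) k *
                (cVal H G b Ai j + vVec H G S Ai j ⬝ᵥ θ) ≤
            b k + S.mulVec θ k) ∧
        (∀ k ∈ insert j Ai,
          0 ≤ lamExt H G b S Ai θ k -
              dExt H G Ai j k * (cVal H G b Ai j + vVec H G S Ai j ⬝ᵥ θ)))) ∧
    (∀ k ∈ insert j Ai,
      G.mulVec (zOf H G b S (insert j Ai) θ) k = b k + S.mulVec θ k) := by
  have hlam := lamExt_insert hH b S hj hAi hAj θ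
  have heq : ∀ k ∈ insert j Ai,
      G.mulVec (zOf H G b S (insert j Ai) θ) k = b k + S.mulVec θ k := fun k hk => by
    rw [mulVec_zOf, Pi.neg_apply, gram_mulVec_lamExt hH b S hAj θ hk, neg_neg]
  have hz : ∀ k, G.mulVec (zOf H G b S (insert j Ai) θ) k =
      G k ⬝ᵥ zOf H G b S Ai θ + G.mulVec (fVec H G Ai j) k *
        (cVal H G b Ai j + vVec H G S Ai j ⬝ᵥ θ) := fun k => by
    change _ = G.mulVec (zOf H G b S Ai θ) k + _
    rw [mulVec_zOf, mulVec_zOf, mulVec_fVec, hlam, mulVec_sub, mulVec_smul]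
    simp only [Pi.neg_apply, Pi.sub_apply, Pi.smul_apply, smul_eq_mul]
    ring
  have hdual : ∀ k (hk : k ∈ insert j Ai), lamOf H G b S (insert j Ai) θ ⟨k, hk⟩ =
      lamExt H G b S Ai θ k -
        dExt H G Ai j k * (cVal H G b Ai j + vVec H G S Ai j ⬝ᵥ θ) := fun k hk => by
    have h := congrFun hlam k
    rwa [lamExt, dif_pos hk, Pi.sub_apply, Pi.smul_apply, smul_eq_mul, mul_comm] at h
  refine ⟨and_congr ⟨fun h k _ => hz k ▸ h k, fun h k => ?_⟩
    ⟨fun h k hk => hdual k hk ▸ h ⟨k, hk⟩, fun h i => (hdual i i.2).symm ▸ h i i.2⟩, heq⟩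
  by_cases hk : k ∈ insert j Ai
  · exact (heq k hk).le
  · exact (hz k).trans_le (h k hk)

end MpQP
end
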